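/- arXiv:2111.04117 — 7 statements merged into one kernel-verified Lean document; each statement's English description precedes it below -/
import Mathlib

section
/- Let n ≥ 1 and let z : ZMod n → ℂ satisfy Im(z i) ≠ 0 for all i. Then Im(z i · conj(z (i+1))) = 0 for all i ∈ ZMod n if and only if there exists a real number α such that Re(z i) = α · Im(z i) for all i ∈ ZMod n. -/
/-- Lemma 2 of the Supplemental Material: for a periodic chain `z : ZMod n → ℂ` of complex
numbers with nonvanishing imaginary parts, `Im(z_i z_{i+1}^*) = 0` for all `i` iff all the
ratios `Re(z_i)/Im(z_i)` coincide, i.e. there is a real `α` with `Re(z_i) = α Im(z_i)`. -/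
theorem coeff_lemma (n : ℕ) (hn : 1 ≤ n) (z : ZMod n → ℂ)
    (hIm : ∀ i, (z i).im ≠ 0) :
    (∀ i : ZMod n, (z i * (starRingEnd ℂ) (z (i + 1))).im = 0) ↔
      ∃ α : ℝ, ∀ i : ZMod n, (z i).re = α * (z i).im := by
  simp only [Complex.mul_im, Complex.conj_re, Complex.conj_im]
  constructor
  · intro h
    refine ⟨(z 0).re / (z 0).im, fun i => ?_⟩
    have key : ∀ k : ℕ, (z (k : ZMod n)).re = (z 0).re / (z 0).im * (z (k : ZMod n)).im := by
      intro k
      induction k with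
      | zero =>
        have h0 := hIm 0
        simp only [Nat.cast_zero]
        field_simp
      | succ k ih =>
        have hk := h (k : ZMod n)
        rw [ih] at hk
        push_cast
        apply mul_left_cancel₀ (hIm (k : ZMod n))
        linear_combination hk
    haveI : NeZero n := ⟨by omega⟩
    have := key i.val
    rwa [ZMod.natCast_zmod_val] at this
  · rintro ⟨α, hα⟩ i
    rw [hα i, hα (i + 1)]
    ring
end

section
/- Let σx, σy, σz be the Pauli matrices and 1 the 2×2 identity in Matrix (Fin 2) (Fin 2) ℂ, let ⊗ denote the Kronecker product, and let z₁, z₂ ∈ ℂ. Then [z₁ • (σx ⊗ σy ⊗ 1) + z₂ • (1 ⊗ σx ⊗ σy), conj(z₁) • (σx ⊗ σy ⊗ 1) + conj(z₂) • (1 ⊗ σx ⊗ σy)] = (4·Im(z₁·conj(z₂)) : ℂ) • (σx ⊗ σz ⊗ σy) as 8×8 complex matrices. -/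
noncomputable section

open Kronecker

def σx : Matrix (Fin 2) (Fin 2) ℂ := !![0, 1; 1, 0]
def σy : Matrix (Fin 2) (Fin 2) ℂ := !![0, -Complex.I; Complex.I, 0]
def σz : Matrix (Fin 2) (Fin 2) ℂ := !![1, 0; 0, -1]

/-- Three-site instance of the self-commutator identity of the Supplemental Material:
`[z₁ σ₁^x σ₂^y + z₂ σ₂^x σ₃^y, z₁* σ₁^x σ₂^y + z₂* σ₂^x σ₃^y] = 4 Im(z₁ z₂*) σ₁^x σ₂^z σ₃^y`. -/
theorem pauli_self_commutator_three_site (z₁ z₂ : ℂ) :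
    (z₁ • ((σx ⊗ₖ σy) ⊗ₖ (1 : Matrix (Fin 2) (Fin 2) ℂ)) +
        z₂ • (((1 : Matrix (Fin 2) (Fin 2) ℂ) ⊗ₖ σx) ⊗ₖ σy)) *
      ((starRingEnd ℂ) z₁ • ((σx ⊗ₖ σy) ⊗ₖ (1 : Matrix (Fin 2) (Fin 2) ℂ)) +
        (starRingEnd ℂ) z₂ • (((1 : Matrix (Fin 2) (Fin 2) ℂ) ⊗ₖ σx) ⊗ₖ σy)) -
      ((starRingEnd ℂ) z₁ • ((σx ⊗ₖ σy) ⊗ₖ (1 : Matrix (Fin 2) (Fin 2) ℂ)) +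
        (starRingEnd ℂ) z₂ • (((1 : Matrix (Fin 2) (Fin 2) ℂ) ⊗ₖ σx) ⊗ₖ σy)) *
      (z₁ • ((σx ⊗ₖ σy) ⊗ₖ (1 : Matrix (Fin 2) (Fin 2) ℂ)) +
        z₂ • (((1 : Matrix (Fin 2) (Fin 2) ℂ) ⊗ₖ σx) ⊗ₖ σy)) =
      ((4 * (z₁ * (starRingEnd ℂ) z₂).im : ℝ) : ℂ) • ((σx ⊗ₖ σz) ⊗ₖ σy) := by
  have hyx : σy * σx = (-Complex.I) • σz := by
    ext i j; fin_cases i <;> fin_cases j <;> simp [σx, σy, σz]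
  have hxy : σx * σy = Complex.I • σz := by
    ext i j; fin_cases i <;> fin_cases j <;> simp [σx, σy, σz]
  have hAB : ((σx ⊗ₖ σy) ⊗ₖ (1 : Matrix (Fin 2) (Fin 2) ℂ)) *
      (((1 : Matrix (Fin 2) (Fin 2) ℂ) ⊗ₖ σx) ⊗ₖ σy) =
      (-Complex.I) • ((σx ⊗ₖ σz) ⊗ₖ σy) := by
    rw [← Matrix.mul_kronecker_mul, ← Matrix.mul_kronecker_mul, hyx, mul_one, one_mul,
      Matrix.kronecker_smul, Matrix.smul_kronecker]
  have hBA : (((1 : Matrix (Fin 2) (Fin 2) ℂ) ⊗ₖ σx) ⊗ₖ σy) *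
      ((σx ⊗ₖ σy) ⊗ₖ (1 : Matrix (Fin 2) (Fin 2) ℂ)) =
      Complex.I • ((σx ⊗ₖ σz) ⊗ₖ σy) := by
    rw [← Matrix.mul_kronecker_mul, ← Matrix.mul_kronecker_mul, hxy, mul_one, one_mul,
      Matrix.kronecker_smul, Matrix.smul_kronecker]
  have hc : ((4 * (z₁ * (starRingEnd ℂ) z₂).im : ℝ) : ℂ) =
      -2 * Complex.I * (z₁ * (starRingEnd ℂ) z₂ - z₂ * (starRingEnd ℂ) z₁) := by
    apply Complex.ext <;> simp <;> ring
  rw [hc]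
  generalize (σx ⊗ₖ σy) ⊗ₖ (1 : Matrix (Fin 2) (Fin 2) ℂ) = A at *
  generalize ((1 : Matrix (Fin 2) (Fin 2) ℂ) ⊗ₖ σx) ⊗ₖ σy = B at *
  simp only [add_mul, mul_add, Matrix.smul_mul, Matrix.mul_smul, hAB, hBA]
  module
end
end

section
/- Let σx, σy, σz be the Pauli matrices in Matrix (Fin 2) (Fin 2) ℂ, let λ, Δ, ω, c₀ʸ, c₀ᶻ be real numbers with ω ≠ 0, and let cʸ, cᶻ : ℕ → ℂ be such that the function l ↦ Im(cʸ(l+1)·conj(cᶻ(l+1)))/(l+1) is summable. Define H_F := (λ/2 : ℂ)•σz + (Δ/2 : ℂ)•σx + (c₀ʸ : ℂ)•σy + (c₀ᶻ : ℂ)•σz + (1/ω : ℂ) • ∑' (l : ℕ), ((l+1 : ℂ))⁻¹ • [cʸ(l+1)•σy + cᶻ(l+1)•σz, conj(cʸ(l+1))•σy + conj(cᶻ(l+1))•σz]. Then H_F = ((λ/2 + c₀ᶻ : ℝ) : ℂ)•σz + ((Δ/2 − (4/ω)·∑' (l : ℕ), Im(cʸ(l+1)·conj(cᶻ(l+1)))/(l+1)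 : ℝ) : ℂ)•σx + (c₀ʸ : ℂ)•σy. -/
noncomputable section

/-- The first-order Floquet effective Hamiltonian for the qubit sensing Hamiltonian
`H_λ = (λ/2)σz + (Δ/2)σx` with static control `c₀ʸ σy + c₀ᶻ σz` and harmonic drive
`H_{c,l} = cʸ_l σy + cᶻ_l σz` (the index `l ≥ 1` is encoded as `l + 1` with `l : ℕ`). -/
def floquetHF (lam Δ ω c0y c0z : ℝ) (cy cz : ℕ → ℂ) : Matrix (Fin 2) (Fin 2) ℂ :=
  (lam / 2 : ℂ) • σz + (Δ / 2 : ℂ) • σx + (c0y : ℂ) • σy + (c0z : ℂ) • σz +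
    (1 / ω : ℂ) • ∑' l : ℕ, ((l + 1 : ℂ))⁻¹ •
      ((cy (l + 1) • σy + cz (l + 1) • σz) *
          ((starRingEnd ℂ) (cy (l + 1)) • σy + (starRingEnd ℂ) (cz (l + 1)) • σz) -
        ((starRingEnd ℂ) (cy (l + 1)) • σy + (starRingEnd ℂ) (cz (l + 1)) • σz) *
          (cy (l + 1) • σy + cz (l + 1) • σz))

/-- The qubit Floquet effective Hamiltonian equals
`(λ/2 + c₀ᶻ)σz + (Δ/2 − (4/ω) Σ_{l≥1} Im(cʸ_l cᶻ_l*)/l)σx + c₀ʸ σy`. -/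
theorem floquetHF_eq (lam Δ ω c0y c0z : ℝ) (hω : ω ≠ 0) (cy cz : ℕ → ℂ)
    (hsum : Summable fun l : ℕ =>
      (cy (l + 1) * (starRingEnd ℂ) (cz (l + 1))).im / (l + 1)) :
    floquetHF lam Δ ω c0y c0z cy cz =
      ((lam / 2 + c0z : ℝ) : ℂ) • σz +
        ((Δ / 2 - (4 / ω) * ∑' l : ℕ,
            (cy (l + 1) * (starRingEnd ℂ) (cz (l + 1))).im / (l + 1) : ℝ) : ℂ) • σx +
        (c0y : ℂ) • σy := by
  have hterm : ∀ l : ℕ, ((l + 1 : ℂ))⁻¹ •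
      ((cy (l + 1) • σy + cz (l + 1) • σz) *
          ((starRingEnd ℂ) (cy (l + 1)) • σy + (starRingEnd ℂ) (cz (l + 1)) • σz) -
        ((starRingEnd ℂ) (cy (l + 1)) • σy + (starRingEnd ℂ) (cz (l + 1)) • σz) *
          (cy (l + 1) • σy + cz (l + 1) • σz)) =
      (((-4 * ((cy (l + 1) * (starRingEnd ℂ) (cz (l + 1))).im / (l + 1)) : ℝ)) : ℂ) • σx := by
    intro l
    have him : cy (l + 1) * (starRingEnd ℂ) (cz (l + 1)) -
        (starRingEnd ℂ) (cy (l + 1)) * cz (l + 1) =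
        2 * ((cy (l + 1) * (starRingEnd ℂ) (cz (l + 1))).im : ℂ) * Complex.I := by
      apply Complex.ext <;> simp <;> ring
    generalize (cy (l + 1) * (starRingEnd ℂ) (cz (l + 1))).im = t at him ⊢
    generalize (starRingEnd ℂ) (cy (l + 1)) = ac at him ⊢
    generalize (starRingEnd ℂ) (cz (l + 1)) = bc at him ⊢
    generalize cy (l + 1) = a at him ⊢
    generalize cz (l + 1) = b at him ⊢
    have hI := Complex.I_mul_I
    push_cast
    ext i j
    fin_cases i <;> fin_cases j <;>
      simp [σx, σy, σz, Matrix.mul_apply, Fin.sum_univ_two, div_eq_mul_inv] <;>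
      first
        | (right; ring)
        | (linear_combination ((l : ℂ) + 1)⁻¹ * (2 * Complex.I * him + 4 * t * hI))
  have hs : HasSum (fun l : ℕ =>
      (((-4 * ((cy (l + 1) * (starRingEnd ℂ) (cz (l + 1))).im / (l + 1)) : ℝ)) : ℂ) • σx)
      (((-4 * ∑' l : ℕ, (cy (l + 1) * (starRingEnd ℂ) (cz (l + 1))).im / (l + 1) : ℝ) : ℂ)
        • σx) :=
    (Complex.hasSum_ofReal.mpr (hsum.hasSum.mul_left (-4))).smul_const σx
  unfold floquetHF
  rw [tsum_congr hterm, hs.tsum_eq]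
  push_cast
  module
end
end

section
/- Under the hypotheses and definitions of the qubit Floquet effective Hamiltonian H_F (with λ, Δ, ω, c₀ʸ, c₀ᶻ real, ω ≠ 0, cʸ, cᶻ : ℕ → ℂ, and l ↦ Im(cʸ(l+1)·conj(cᶻ(l+1)))/(l+1) summable), assume additionally the amplitude-frequency matching condition ω = (8/Δ)·∑' (l : ℕ), Im(cʸ(l+1)·conj(cᶻ(l+1)))/(l+1) with Δ ≠ 0, and c₀ʸ = 0. Then H_F = ((λ/2 + c₀ᶻ : ℝ) : ℂ)•σz; in particular H_F commutes with σz: H_F * σz = σz * H_F. -/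
noncomputable section

theorem floquet_term (a b k : ℂ) :
    k⁻¹ • ((a • σy + b • σz) *
          ((starRingEnd ℂ) a • σy + (starRingEnd ℂ) b • σz) -
        ((starRingEnd ℂ) a • σy + (starRingEnd ℂ) b • σz) * (a • σy + b • σz)) =
      (((a * (starRingEnd ℂ) b).im : ℂ) / k) • ((-4 : ℂ) • σx) := by
  have h : a * (starRingEnd ℂ) b - b * (starRingEnd ℂ) a
      = 2 * Complex.I * ((a * (starRingEnd ℂ) b).im : ℂ) := by
    apply Complex.ext <;> simp <;> ring
  have h2 := Complex.I_mul_I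
  generalize ((a * (starRingEnd ℂ) b).im : ℂ) = m at *
  generalize (starRingEnd ℂ) a = a' at *
  generalize (starRingEnd ℂ) b = b' at *
  ext i j
  fin_cases i <;> fin_cases j <;>
    simp [σx, σy, σz, Matrix.mul_apply, Fin.sum_univ_two, div_eq_mul_inv]
  · right; ring
  · linear_combination (2 * k⁻¹ * Complex.I) * h + (4 * m * k⁻¹) * h2
  · linear_combination (2 * k⁻¹ * Complex.I) * h + (4 * m * k⁻¹) * h2
  · right; ring

/-- Under the amplitude-frequency matching condition
`ω = (8/Δ) Σ_{l≥1} Im(cʸ_l cᶻ_l*)/l` and with vanishing static `σy` control, the Floquet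
effective Hamiltonian reduces to `(λ/2 + c₀ᶻ)σz`; in particular it commutes with `σz`. -/
theorem floquetHF_AFM (lam Δ ω c0y c0z : ℝ) (hω : ω ≠ 0) (hΔ : Δ ≠ 0) (cy cz : ℕ → ℂ)
    (hsum : Summable fun l : ℕ =>
      (cy (l + 1) * (starRingEnd ℂ) (cz (l + 1))).im / (l + 1))
    (hAFM : ω = (8 / Δ) * ∑' l : ℕ,
      (cy (l + 1) * (starRingEnd ℂ) (cz (l + 1))).im / (l + 1))
    (hc0y : c0y = 0) :
    floquetHF lam Δ ω c0y c0z cy cz = ((lam / 2 + c0z : ℝ) : ℂ) • σz ∧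
      floquetHF lam Δ ω c0y c0z cy cz * σz = σz * floquetHF lam Δ ω c0y c0z cy cz := by
  have hF : floquetHF lam Δ ω c0y c0z cy cz = ((lam / 2 + c0z : ℝ) : ℂ) • σz := by
    have hS := Complex.hasSum_ofReal.mpr hsum.hasSum
    set S := ∑' l : ℕ, (cy (l + 1) * (starRingEnd ℂ) (cz (l + 1))).im / ((l : ℝ) + 1) with hSdef
    have hM := hS.smul_const ((-4 : ℂ) • σx)
    have hr : (1 / ω) * S = Δ / 8 := by
      have h8 : ω * Δ = 8 * S := by
        rw [hAFM]; field_simp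
      field_simp
      linarith
    have hrc : (1 / (ω : ℂ)) * (S : ℂ) = (Δ : ℂ) / 8 := by exact_mod_cast hr
    unfold floquetHF
    simp only [floquet_term]
    push_cast at hM
    rw [hM.tsum_eq, smul_smul, hrc, hc0y]
    push_cast
    module
  refine ⟨hF, ?_⟩
  rw [hF, smul_mul_assoc, mul_smul_comm]
end
end

section
/- Let d ≥ 1 and let U : ℝ → ℝ → Matrix (Fin d) (Fin d) ℂ (first argument the parameter λ, second the time t) and H : ℝ → ℝ → Matrix (Fin d) (Fin d) ℂ satisfy: (i) the uncurried map (λ,t) ↦ U λ t is C² on ℝ × ℝ; (ii) H is continuous and for each t the map λ ↦ H λ t is differentiable with jointly continuous derivative dH λ t; (iii) for every λ and t, the t-derivative of U λ · at t equals (−i : ℂ) • (H λ t * U λ t); (iv) U λ 0 = 1 for all λ; (v) U λ t is unitary for all λ, t, i.e., (U λ t)ᴴ * U λ t = 1. Then for all λ and all t, (i : ℂ) • ((U λ t)ᴴ * ∂U λ t) = ∫ τ in (0:ℝ)..t, (U λ τ)ᴴ * dH λ τ * U λ τ, where ∂U λ t denotes the derivative of λ' ↦ U λ' t at λ. -/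
noncomputable section

open Matrix

attribute [local instance] Matrix.normedAddCommGroup Matrix.normedSpace

theorem hasDerivAt_matrix_mul_aux {d : ℕ} {A B : ℝ → Matrix (Fin d) (Fin d) ℂ}
    {A' B' : Matrix (Fin d) (Fin d) ℂ} {x : ℝ} (hA : HasDerivAt A A' x) (hB : HasDerivAt B B' x) :
    HasDerivAt (fun y => A y * B y) (A' * B x + A x * B') x := by
  have hA2 : ∀ i j, HasDerivAt (fun y => A y i j) (A' i j) x := fun i j =>
    hasDerivAt_pi.1 (hasDerivAt_pi.1 hA i) j
  have hB2 : ∀ i j, HasDerivAt (fun y => B y i j) (B' i j) x := fun i j =>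
    hasDerivAt_pi.1 (hasDerivAt_pi.1 hB i) j
  refine hasDerivAt_pi.2 fun i => hasDerivAt_pi.2 fun j => ?_
  have := HasDerivAt.fun_sum (u := Finset.univ) fun k _ => (hA2 i k).mul (hB2 k j)
  simpa [Matrix.mul_apply, Finset.sum_add_distrib] using this

theorem hasDerivAt_conjTranspose_aux {d : ℕ} {A : ℝ → Matrix (Fin d) (Fin d) ℂ}
    {A' : Matrix (Fin d) (Fin d) ℂ} {x : ℝ} (hA : HasDerivAt A A' x) :
    HasDerivAt (fun y => (A y)ᴴ) (A'ᴴ) x := by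
  have hA2 : ∀ i j, HasDerivAt (fun y => A y i j) (A' i j) x := fun i j =>
    hasDerivAt_pi.1 (hasDerivAt_pi.1 hA i) j
  refine hasDerivAt_pi.2 fun i => hasDerivAt_pi.2 fun j => ?_
  exact (hA2 j i).star

theorem mixed_deriv_aux {E : Type*} [NormedAddCommGroup E] [NormedSpace ℝ E]
    {F : ℝ × ℝ → E} (hF : ContDiff ℝ 2 F) {a b : ℝ → ℝ → E}
    (ha : ∀ l t, HasDerivAt (fun l' => F (l', t)) (a l t) l)
    (hb : ∀ l t, HasDerivAt (fun s => F (l, s)) (b l t) t)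
    {l t : ℝ} {c : E} (hc : HasDerivAt (fun l' => b l' t) c l) :
    HasDerivAt (fun s => a l s) c t := by
  have hd : Differentiable ℝ F := hF.differentiable (by norm_num)
  have hd2 : Differentiable ℝ (fderiv ℝ F) :=
    (hF.fderiv_right (m := 1) (by norm_num)).differentiable (by norm_num)
  have p1 : ∀ l t : ℝ, HasDerivAt (fun l' : ℝ => (l', t)) ((1 : ℝ), (0 : ℝ)) l := fun l t =>
    (hasDerivAt_id l).prodMk (hasDerivAt_const l t)
  have p2 : ∀ l t : ℝ, HasDerivAt (fun s : ℝ => (l, s)) ((0 : ℝ), (1 : ℝ)) t := fun l t =>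
    (hasDerivAt_const t l).prodMk (hasDerivAt_id t)
  have ea : ∀ l t, a l t = fderiv ℝ F (l, t) (1, 0) := fun l t =>
    (ha l t).unique ((hd (l, t)).hasFDerivAt.comp_hasDerivAt l (p1 l t))
  have eb : ∀ l t, b l t = fderiv ℝ F (l, t) (0, 1) := fun l t =>
    (hb l t).unique ((hd (l, t)).hasFDerivAt.comp_hasDerivAt t (p2 l t))
  have h1 : HasDerivAt (fun l' => fderiv ℝ F (l', t)) _ l :=
    (hd2 (l, t)).hasFDerivAt.comp_hasDerivAt l (p1 l t)
  have h2 : HasDerivAt (fun s => fderiv ℝ F (l, s)) _ t :=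
    (hd2 (l, t)).hasFDerivAt.comp_hasDerivAt t (p2 l t)
  have hfst := h1.clm_apply (hasDerivAt_const l ((0 : ℝ), (1 : ℝ)))
  have hsnd := h2.clm_apply (hasDerivAt_const t ((1 : ℝ), (0 : ℝ)))
  have hs := second_derivative_symmetric (𝕜 := ℝ) (fun y => (hd y).hasFDerivAt)
    (hd2 (l, t)).hasFDerivAt ((1 : ℝ), (0 : ℝ)) ((0 : ℝ), (1 : ℝ))
  simp only [eb] at hc
  simp only [ea]
  have e := hc.unique hfst
  rw [e]
  simpa [hs] using hsnd

/-- The generator of parameter estimation: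
`i U†(t) ∂_λU(t) = ∫₀ᵗ U†(τ) ∂_λH_λ(τ) U(τ) dτ` for a unitary evolution satisfying the
Schrödinger equation `i ∂_t U = H U` with `U(0) = 1`. -/
theorem generator_integral_representation {d : ℕ} (hd : 1 ≤ d)
    (U H dH dU : ℝ → ℝ → Matrix (Fin d) (Fin d) ℂ)
    (hU_C2 : ContDiff ℝ 2 fun p : ℝ × ℝ => U p.1 p.2)
    (hH_cont : Continuous fun p : ℝ × ℝ => H p.1 p.2)
    (hH_diff : ∀ lam t, HasDerivAt (fun lam' => H lam' t) (dH lam t) lam)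
    (hdH_cont : Continuous fun p : ℝ × ℝ => dH p.1 p.2)
    (hSchrodinger : ∀ lam t, HasDerivAt (fun s => U lam s) ((-Complex.I) • (H lam t * U lam t)) t)
    (hU0 : ∀ lam, U lam 0 = 1)
    (hUnitary : ∀ lam t, (U lam t)ᴴ * U lam t = 1)
    (hdU : ∀ lam t, HasDerivAt (fun lam' => U lam' t) (dU lam t) lam) :
    ∀ lam t, Complex.I • ((U lam t)ᴴ * dU lam t) =
      ∫ τ in (0:ℝ)..t, (U lam τ)ᴴ * dH lam τ * U lam τ := by
  intro lam t
  have hdU0 : dU lam 0 = 0 := by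
    have h := hdU lam 0
    simp only [hU0] at h
    exact h.unique (hasDerivAt_const _ _)
  -- the mixed derivative
  have hmix : ∀ τ, HasDerivAt (fun s => dU lam s)
      ((-Complex.I) • (dH lam τ * U lam τ + H lam τ * dU lam τ)) τ := fun τ =>
    mixed_deriv_aux (F := fun p : ℝ × ℝ => U p.1 p.2) hU_C2 hdU hSchrodinger
      ((hasDerivAt_matrix_mul_aux (hH_diff lam τ) (hdU lam τ)).const_smul (-Complex.I))
  have hstar : ∀ τ, HasDerivAt (fun s => (U lam s)ᴴ) (((-Complex.I) • (H lam τ * U lam τ))ᴴ) τ :=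
    fun τ => hasDerivAt_conjTranspose_aux (hSchrodinger lam τ)
  have hskew : ∀ τ, ((-Complex.I) • (H lam τ * U lam τ))ᴴ = Complex.I • ((U lam τ)ᴴ * H lam τ) := by
    intro τ
    have h := hasDerivAt_matrix_mul_aux (hstar τ) (hSchrodinger lam τ)
    simp only [hUnitary] at h
    have h0 := h.unique (hasDerivAt_const _ _)
    have hr : U lam τ * (U lam τ)ᴴ = 1 := mul_eq_one_comm.1 (hUnitary lam τ)
    have h1 := congrArg (fun M => M * (U lam τ)ᴴ) h0
    simp only [add_mul, mul_assoc, hr, mul_one, zero_mul, Matrix.smul_mul, Matrix.mul_smul, neg_mul, mul_neg,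
      neg_smul] at h1
    rw [← sub_eq_add_neg, sub_eq_zero] at h1
    simpa using h1
  have hG : ∀ τ, HasDerivAt (fun s => Complex.I • ((U lam s)ᴴ * dU lam s))
      ((U lam τ)ᴴ * dH lam τ * U lam τ) τ := by
    intro τ
    have h := (hasDerivAt_matrix_mul_aux (hstar τ) (hmix τ)).const_smul Complex.I
    rw [hskew] at h
    refine h.congr_deriv ?_
    simp only [Matrix.smul_mul, Matrix.mul_smul, neg_mul, mul_neg, smul_add, mul_add, smul_smul, mul_assoc,
      neg_smul, smul_neg, Complex.I_mul_I]
    simp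
  have hUc : Continuous fun s => U lam s :=
    hU_C2.continuous.comp (by fun_prop : Continuous fun s : ℝ => (lam, s))
  have hdHc : Continuous fun s => dH lam s :=
    hdH_cont.comp (by fun_prop : Continuous fun s : ℝ => (lam, s))
  have hc : Continuous fun τ => (U lam τ)ᴴ * dH lam τ * U lam τ :=
    (hUc.matrix_conjTranspose.matrix_mul hdHc).matrix_mul hUc
  have hI := intervalIntegral.integral_eq_sub_of_hasDerivAt (fun τ _ => hG τ)
    (hc.intervalIntegrable 0 t)
  rw [hI, hdU0]
  simp
end
end

section
/- Let d ≥ 1, t_f ≥ 0, let U : ℝ → Matrix (Fin d) (Fin d) ℂ and dH : ℝ → Matrix (Fin d) (Fin d) ℂ be continuous on [0, t_f] with (U τ)ᴴ * U τ = 1 for all τ ∈ [0, t_f], let ν : ℝ → ℝ be continuous on [0, t_f], and let φ ∈ (Fin d → ℂ). If for every τ ∈ [0, t_f] one has dH τ *ᵥ (U τ *ᵥ φ) = (ν τ : ℂ) • (U τ *ᵥ φ), then (∫ τ in (0:ℝ)..t_f, (U τ)ᴴ * dH τ * U τ) *ᵥ φ = ((∫ τ in (0:ℝ)..t_f, ν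 τ : ℝ) : ℂ) • φ. -/
noncomputable section

open Matrix

attribute [local instance] Matrix.normedAddCommGroup Matrix.normedSpace

/-- A linear map on a finite-dimensional real normed space commutes with the interval integral
of a continuous function. -/
theorem linear_map_integral_comm {E F : Type*} [NormedAddCommGroup E] [NormedSpace ℝ E]
    [FiniteDimensional ℝ E] [NormedAddCommGroup F] [NormedSpace ℝ F] [CompleteSpace F]
    (tf : ℝ) (htf : 0 ≤ tf) (f : ℝ → E) (hf : ContinuousOn f (Set.Icc 0 tf)) (L : E →ₗ[ℝ] F) :
    L (∫ τ in (0:ℝ)..tf, f τ) = ∫ τ in (0:ℝ)..tf, L (f τ) := by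
  have : CompleteSpace E := FiniteDimensional.complete ℝ E
  have hint : IntervalIntegrable f MeasureTheory.volume 0 tf := by
    apply ContinuousOn.intervalIntegrable
    rwa [Set.uIcc_of_le htf]
  exact ((LinearMap.toContinuousLinearMap L).intervalIntegral_comp_comm hint).symm

/-- If the controlled unitary dynamics `U(τ)` adiabatically transports `φ` along an
eigenvector of `∂_λH_λ(τ)` with eigenvalue `ν(τ)` at all times `τ ∈ [0, t_f]`, then `φ` is an
eigenvector of the generator `G = ∫₀^{t_f} U†(τ) ∂_λH_λ(τ) U(τ) dτ` with eigenvalue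
`∫₀^{t_f} ν(τ) dτ`. -/
theorem generator_eigenvector_of_adiabatic_transport {d : ℕ} (hd : 1 ≤ d)
    (tf : ℝ) (htf : 0 ≤ tf)
    (U dH : ℝ → Matrix (Fin d) (Fin d) ℂ)
    (hU_cont : ContinuousOn U (Set.Icc 0 tf))
    (hdH_cont : ContinuousOn dH (Set.Icc 0 tf))
    (hUnitary : ∀ τ ∈ Set.Icc (0:ℝ) tf, (U τ)ᴴ * U τ = 1)
    (ν : ℝ → ℝ) (hν_cont : ContinuousOn ν (Set.Icc 0 tf))
    (φ : Fin d → ℂ)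
    (heig : ∀ τ ∈ Set.Icc (0:ℝ) tf, dH τ *ᵥ (U τ *ᵥ φ) = ((ν τ : ℝ) : ℂ) • (U τ *ᵥ φ)) :
    (∫ τ in (0:ℝ)..tf, (U τ)ᴴ * dH τ * U τ) *ᵥ φ =
      ((∫ τ in (0:ℝ)..tf, ν τ : ℝ) : ℂ) • φ := by
  have hcont : ContinuousOn (fun τ => (U τ)ᴴ * dH τ * U τ) (Set.Icc 0 tf) := by
    rw [continuousOn_iff_continuous_domRestrict] at hU_cont hdH_cont ⊢
    exact (hU_cont.matrix_conjTranspose.matrix_mul hdH_cont).matrix_mul hU_cont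
  let L0 : Matrix (Fin d) (Fin d) ℂ →ₗ[ℝ] (Fin d → ℂ) :=
    { toFun := fun M => M *ᵥ φ
      map_add' := fun A B => Matrix.add_mulVec A B φ
      map_smul' := fun c A => Matrix.smul_mulVec c A φ }
  have hL : ∀ M, L0 M = M *ᵥ φ := fun M => rfl
  have key := linear_map_integral_comm tf htf (fun τ => (U τ)ᴴ * dH τ * U τ) hcont L0
  refine (hL _).symm.trans (key.trans ?_)
  have hcongr : ∫ τ in (0:ℝ)..tf, L0 ((U τ)ᴴ * dH τ * U τ) =
      ∫ τ in (0:ℝ)..tf, ((ν τ : ℝ) : ℂ) • φ := by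
    apply intervalIntegral.integral_congr
    intro τ hτ
    rw [Set.uIcc_of_le htf] at hτ
    simp only [hL]
    rw [← Matrix.mulVec_mulVec, ← Matrix.mulVec_mulVec, heig τ hτ, Matrix.mulVec_smul,
      Matrix.mulVec_mulVec, hUnitary τ hτ, Matrix.one_mulVec]
  rw [hcongr, intervalIntegral.integral_smul_const, intervalIntegral.integral_ofReal]
end
end

section
/- Let d ≥ 1, let ρ : ℝ → Matrix (Fin d) (Fin d) ℂ, and let H : ℝ → ℝ → Matrix (Fin d) (Fin d) ℂ (first argument the parameter λ, second the time τ). Fix λ₀ and τ₀, and suppose: (i) ρ is differentiable at τ₀ with derivative ρ'; (ii) for every λ in a neighborhood of λ₀, ρ' = (−i : ℂ) • (H λ τ₀ * ρ τ₀ − ρ τ₀ * H λ τ₀); (iii) λ ↦ H λ τ₀ is differentiable at λ₀ with derivative dH. Then dH * ρ τ₀ − ρ τ₀ * dH = 0, i.e., [∂_λH_λ(τ₀), ρ(τ₀)] = 0. -/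
noncomputable section

attribute [local instance] Matrix.normedAddCommGroup Matrix.normedSpace

/-- If the evolved operator `ρ(τ)` satisfies the Liouville equation
`∂_τρ = −i[H_λ(τ₀), ρ(τ₀)]` with the same left-hand side for all `λ` near `λ₀`, then
differentiating in `λ` forces `[∂_λH_λ(τ₀), ρ(τ₀)] = 0`. -/
theorem dLambdaH_commutes_of_lambda_independent_liouville {d : ℕ} (hd : 1 ≤ d)
    (ρ : ℝ → Matrix (Fin d) (Fin d) ℂ)
    (H : ℝ → ℝ → Matrix (Fin d) (Fin d) ℂ)
    (lam₀ τ₀ : ℝ)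
    (ρ' : Matrix (Fin d) (Fin d) ℂ) (hρ : HasDerivAt ρ ρ' τ₀)
    (hLiouville : ∀ᶠ lam in nhds lam₀,
      ρ' = (-Complex.I) • (H lam τ₀ * ρ τ₀ - ρ τ₀ * H lam τ₀))
    (dH : Matrix (Fin d) (Fin d) ℂ)
    (hH : HasDerivAt (fun lam => H lam τ₀) dH lam₀) :
    dH * ρ τ₀ - ρ τ₀ * dH = 0 := by
  let L : Matrix (Fin d) (Fin d) ℂ →ₗ[ℝ] Matrix (Fin d) (Fin d) ℂ :=
    LinearMap.mulRight ℝ (ρ τ₀) - LinearMap.mulLeft ℝ (ρ τ₀)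
  have hL : ∀ X, L X = X * ρ τ₀ - ρ τ₀ * X := fun X => by simp [L]
  have h1 : HasDerivAt (fun lam => L (H lam τ₀)) (L dH) lam₀ :=
    (LinearMap.toContinuousLinearMap L).hasFDerivAt.comp_hasDerivAt lam₀ hH
  have h2 : HasDerivAt (fun lam => L (H lam τ₀)) 0 lam₀ := by
    refine (hasDerivAt_const lam₀ (Complex.I • ρ')).congr_of_eventuallyEq ?_
    filter_upwards [hLiouville] with lam hlam
    rw [hL, hlam, smul_smul]
    simp
  rw [← hL]
  exact h1.unique h2
end
end
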